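/- arXiv:2210.10030 — 2 statements merged into one kernel-verified Lean document; each statement's English description precedes it below -/
import Mathlib

section
/- Fix ψ ∈ C_c^∞(ℝ³;[0,1]) with supp ψ ⊆ B(0,1) and ∫ψ = 1; set ψ_l(x) := l^{−3}ψ(x/l) and ψ̃_l := ψ_l * ψ_l. There exists a constant c > 0 depending only on ψ such that: for every δ ∈ (0,1/2), every bounded continuous b : ℝ³ → ℝ³ that is nearly-spherical with constant δ, and every l > 0, one has sup_{x∈ℝ³} |(ψ̃_l * (b(·)/|·|))(x)| ≥ c·δ·‖b‖_{L^∞(ℝ³)} / l. -/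
noncomputable section
open Real MeasureTheory Filter Metric Set
open scoped ENNReal NNReal Topology FourierTransform

/-- Three-dimensional Euclidean space. -/
abbrev E3 : Type := EuclideanSpace ℝ (Fin 3)

/-- The `i`-th partial derivative of a scalar function on `ℝ³`. -/
def pd (f : E3 → ℝ) (i : Fin 3) (x : E3) : ℝ :=
  fderiv ℝ f x (EuclideanSpace.single i 1)

/-- The Laplacian of a scalar function on `ℝ³`. -/
def lap (f : E3 → ℝ) (x : E3) : ℝ :=
  ∑ i : Fin 3, pd (fun y => pd f i y) i x

/-- `(u, pr)` is a classical solution of the Navier–Stokes equations on the time interval `I`. -/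
def IsNSSol (u : ℝ → E3 → E3) (pr : ℝ → E3 → ℝ) (I : Set ℝ) : Prop :=
  (ContDiff ℝ (⊤:ℕ∞) fun q : ℝ × E3 => u q.1 q.2) ∧
  (ContDiff ℝ (⊤:ℕ∞) fun q : ℝ × E3 => pr q.1 q.2) ∧
  (∀ t ∈ I, ∀ x : E3, ∀ i : Fin 3,
    deriv (fun s => u s x i) t - lap (fun y => u t y i) x
      + (∑ j : Fin 3, u t x j * pd (fun y => u t y i) j x) + pd (pr t) i x = 0) ∧
  (∀ t ∈ I, ∀ x : E3, (∑ i : Fin 3, pd (fun y => u t y i) i x) = 0)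

/-- Rotation by angle `θ` about the `x₃`-axis. -/
def rotZ (θ : ℝ) (x : E3) : E3 :=
  (WithLp.equiv 2 (Fin 3 → ℝ)).symm
    ![x 0 * Real.cos θ - x 1 * Real.sin θ, x 0 * Real.sin θ + x 1 * Real.cos θ, x 2]

/-- A time-dependent vector field is axisymmetric. -/
def AxiSym (u : ℝ → E3 → E3) : Prop := ∀ θ t x, u t (rotZ θ x) = rotZ θ (u t x)

/-- The weak `L^q` (quasi)norm `sup_{λ>0} λ · vol{|f| ≥ λ}^{1/q}`. -/
def wnorm' {F : Type*} [NormedAddCommGroup F] (f : E3 → F) (q : ℝ) : ℝ≥0∞ :=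
  ⨆ (l : ℝ) (_ : 0 < l), ENNReal.ofReal l * (volume {x : E3 | l ≤ ‖f x‖}) ^ (1 / q)

/-- The weak `L^3` norm. -/
def wnorm3 (f : E3 → E3) : ℝ≥0∞ := wnorm' f 3

/-- Distance to the `x₃`-axis. -/
def rr (x : E3) : ℝ := Real.sqrt (x 0 ^ 2 + x 1 ^ 2)

/-- `ψ` is a mollifier profile: smooth, valued in `[0,1]`, supported in the unit ball,
with unit integral. -/
def MollifierProfile (ψ : E3 → ℝ) : Prop :=
  ContDiff ℝ (⊤:ℕ∞) ψ ∧ (∀ x, ψ x ∈ Set.Icc (0:ℝ) 1) ∧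
    tsupport ψ ⊆ Metric.closedBall 0 1 ∧ (∫ x, ψ x) = 1

/-- The rescaled mollifier `ψ_l(x) = l⁻³ ψ(x/l)`. -/
def psil (ψ : E3 → ℝ) (l : ℝ) (x : E3) : ℝ := l⁻¹ ^ 3 * ψ (l⁻¹ • x)

/-- The convolution `k * (b(·)/|·|)`. -/
def convK (k : E3 → ℝ) (b : E3 → E3) (x : E3) : E3 :=
  ∫ y : E3, (k (x - y) * ‖y‖⁻¹) • b y

/-- `b` is nearly-spherical with constant `δ`. -/
def NearlySph (b : E3 → E3) (δ : ℝ) : Prop :=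
  ∀ R : ℝ, 0 < R → ∃ x0 : E3, ‖x0‖ = R ∧ (⨆ x : E3, ‖b x‖) / 2 ≤ ‖b x0‖ ∧
    ∀ x ∈ Metric.ball x0 (δ * ‖x0‖), ‖b x - b x0‖ ≤ (⨆ x : E3, ‖b x‖) / 4

/-- If `b` stays within `r` of `v` where the weight `w ≥ 0` is nonzero, the weighted integral
of `b` is at least `(∫ w) * (‖v‖ - r)` in norm. -/
theorem integral_mul_sub_le_norm_integral_smul {α F : Type*} [MeasurableSpace α] {μ : Measure α}
    [NormedAddCommGroup F] [NormedSpace ℝ F] [CompleteSpace F] {w : α → ℝ} {b : α → F} {v : F}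
    {r : ℝ} (hw0 : ∀ y, 0 ≤ w y) (hw : Integrable w μ) (hwb : Integrable (fun y => w y • b y) μ)
    (h : ∀ y, w y ≠ 0 → ‖b y - v‖ ≤ r) :
    (∫ y, w y ∂μ) * (‖v‖ - r) ≤ ‖∫ y, w y • b y ∂μ‖ := by
  have hv : Integrable (fun y => w y • v) μ := hw.smul_const v
  have hsub : (∫ y, w y ∂μ) • v - ∫ y, w y • b y ∂μ = ∫ y, (w y • v - w y • b y) ∂μ := by
    rw [integral_sub hv hwb, integral_smul_const]
  have hle : ‖∫ y, (w y • v - w y • b y) ∂μ‖ ≤ (∫ y, w y ∂μ) * r := by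
    rw [← integral_mul_const]
    refine norm_integral_le_of_norm_le (hw.mul_const r) (Eventually.of_forall fun y => ?_)
    rw [← smul_sub, norm_smul, Real.norm_of_nonneg (hw0 y), norm_sub_rev]
    by_cases hy : w y = 0
    · simp [hy]
    · exact mul_le_mul_of_nonneg_left (h y hy) (hw0 y)
  have htri := norm_sub_norm_le ((∫ y, w y ∂μ) • v) (∫ y, w y • b y ∂μ)
  rw [hsub, norm_smul, Real.norm_of_nonneg (integral_nonneg hw0)] at htri
  linarith

section Mollifier

variable {ψ : E3 → ℝ} {l : ℝ}

theorem psil_nonneg (hψ : MollifierProfile ψ) (hl : 0 < l) (x : E3) : 0 ≤ psil ψ l x :=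
  mul_nonneg (by positivity) (hψ.2.1 _).1

theorem psil_eq_zero (hψ : MollifierProfile ψ) (hl : 0 < l) {x : E3} (hx : l < ‖x‖) :
    psil ψ l x = 0 := by
  have hnot : l⁻¹ • x ∉ tsupport ψ := fun hmem => by
    have hle := mem_closedBall_zero_iff.1 (hψ.2.2.1 hmem)
    rw [norm_smul, norm_inv, Real.norm_of_nonneg hl.le, inv_mul_le_iff₀ hl] at hle
    linarith
  rw [psil, image_eq_zero_of_notMem_tsupport hnot, mul_zero]

theorem integrable_psil (hψ : MollifierProfile ψ) (hl : 0 < l) : Integrable (psil ψ l) := by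
  have hint : Integrable ψ := by
    by_contra hn
    exact zero_ne_one ((integral_undef hn).symm.trans hψ.2.2.2)
  exact (hint.comp_smul (inv_ne_zero hl.ne')).const_mul _

theorem integral_psil (hψ : MollifierProfile ψ) (hl : 0 < l) : ∫ x, psil ψ l x = 1 := by
  simp only [psil]
  rw [integral_const_mul, Measure.integral_comp_smul, hψ.2.2.2, finrank_euclideanSpace_fin,
    abs_of_pos (by positivity), smul_eq_mul, mul_one, mul_inv_cancel₀ (by positivity)]

theorem integral_psil_mul_psil_eq_convolution (ψ : E3 → ℝ) (l : ℝ) :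
    (fun z => ∫ y : E3, psil ψ l (z - y) * psil ψ l y) =
      convolution (psil ψ l) (psil ψ l) (ContinuousLinearMap.mul ℝ ℝ) volume := by
  ext z
  simp only [convolution, ContinuousLinearMap.mul_apply', mul_comm]

theorem integral_psil_mul_psil_nonneg (hψ : MollifierProfile ψ) (hl : 0 < l) (z : E3) :
    0 ≤ ∫ y : E3, psil ψ l (z - y) * psil ψ l y :=
  integral_nonneg fun _ => mul_nonneg (psil_nonneg hψ hl _) (psil_nonneg hψ hl _)

theorem integral_psil_mul_psil_eq_zero (hψ : MollifierProfile ψ) (hl : 0 < l) {z : E3}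
    (hz : 2 * l < ‖z‖) : ∫ y : E3, psil ψ l (z - y) * psil ψ l y = 0 := by
  refine integral_eq_zero_of_ae (Eventually.of_forall fun y => ?_)
  rcases lt_or_ge l ‖y‖ with hy | hy
  · simp [psil_eq_zero hψ hl hy]
  · have : l < ‖z - y‖ := by linarith [norm_sub_norm_le z y]
    simp [psil_eq_zero hψ hl this]

theorem integrable_integral_psil_mul_psil (hψ : MollifierProfile ψ) (hl : 0 < l) :
    Integrable fun z => ∫ y : E3, psil ψ l (z - y) * psil ψ l y := by
  rw [integral_psil_mul_psil_eq_convolution]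
  exact (integrable_psil hψ hl).integrable_convolution _ (integrable_psil hψ hl)

theorem integral_integral_psil_mul_psil (hψ : MollifierProfile ψ) (hl : 0 < l) :
    ∫ z, ∫ y : E3, psil ψ l (z - y) * psil ψ l y = 1 := by
  rw [integral_psil_mul_psil_eq_convolution,
    integral_convolution _ (integrable_psil hψ hl) (integrable_psil hψ hl), integral_psil hψ hl]
  simp

end Mollifier

/-- A nonnegative kernel of unit mass supported in the ball of radius `ρ`, applied to `b(·)/|·|`
at a point `x₀` far from the origin near which `b` is almost constant. -/
theorem le_norm_convK {k : E3 → ℝ} (hk0 : ∀ z, 0 ≤ k z) (hk : Integrable k) (hk1 : ∫ z, k z = 1)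
    {ρ : ℝ} (hkρ : ∀ z, ρ < ‖z‖ → k z = 0) {b : E3 → E3} (hb : Continuous b) {B : ℝ}
    (hB : ∀ x, ‖b x‖ ≤ B) {x₀ : E3} (hx₀ : ρ < ‖x₀‖) {r : ℝ} (hr : r ≤ ‖b x₀‖)
    (hbr : ∀ y, ‖y - x₀‖ ≤ ρ → ‖b y - b x₀‖ ≤ r) :
    (‖x₀‖ + ρ)⁻¹ * (‖b x₀‖ - r) ≤ ‖convK k b x₀‖ := by
  have hnear : ∀ y, k (x₀ - y) ≠ 0 → ‖y - x₀‖ ≤ ρ := fun y hy => by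
    rw [norm_sub_rev]
    exact not_lt.1 (mt (hkρ _) hy)
  have hkx : Integrable fun y => k (x₀ - y) := hk.comp_sub_left x₀
  have hw : Integrable fun y => k (x₀ - y) * ‖y‖⁻¹ := by
    refine (hkx.mul_const (‖x₀‖ - ρ)⁻¹).mono'
      (hkx.1.mul measurable_norm.inv.aestronglyMeasurable) (Eventually.of_forall fun y => ?_)
    rw [Real.norm_of_nonneg (mul_nonneg (hk0 _) (by positivity))]
    by_cases hy : k (x₀ - y) = 0
    · simp [hy]
    · have h1 := hnear y hy
      have h2 := norm_sub_norm_le x₀ y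
      rw [norm_sub_rev] at h2
      exact mul_le_mul_of_nonneg_left (inv_anti₀ (by linarith) (by linarith)) (hk0 _)
  have hwb : Integrable fun y => (k (x₀ - y) * ‖y‖⁻¹) • b y :=
    hw.smul_bdd B hb.aestronglyMeasurable (Eventually.of_forall hB)
  have hmass : (‖x₀‖ + ρ)⁻¹ ≤ ∫ y, k (x₀ - y) * ‖y‖⁻¹ := by
    calc (‖x₀‖ + ρ)⁻¹ = ∫ y, k (x₀ - y) * (‖x₀‖ + ρ)⁻¹ := by
          rw [integral_mul_const, integral_sub_left_eq_self k volume x₀, hk1, one_mul]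
      _ ≤ ∫ y, k (x₀ - y) * ‖y‖⁻¹ := by
          refine integral_mono (hkx.mul_const _) hw fun y => ?_
          by_cases hy : k (x₀ - y) = 0
          · simp [hy]
          · have h1 := hnear y hy
            have h2 := norm_sub_norm_le y x₀
            have h3 := norm_sub_norm_le x₀ y
            rw [norm_sub_rev] at h3
            exact mul_le_mul_of_nonneg_left (inv_anti₀ (by linarith) (by linarith)) (hk0 _)
  refine (mul_le_mul_of_nonneg_right hmass (sub_nonneg.2 hr)).trans ?_
  exact integral_mul_sub_le_norm_integral_smul (fun y => mul_nonneg (hk0 _) (by positivity)) hw hwb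
    fun y hy => hbr y (hnear y (left_ne_zero_of_mul hy))

/-- The mollified self-similar profile has a large sup-norm at scale `l`. -/
theorem stmt3 (ψ : E3 → ℝ) (hψ : MollifierProfile ψ) :
    ∃ c : ℝ, 0 < c ∧
      ∀ δ : ℝ, δ ∈ Set.Ioo (0:ℝ) (1/2) →
        ∀ b : E3 → E3, Continuous b → (∃ M : ℝ, ∀ x : E3, ‖b x‖ ≤ M) → NearlySph b δ →
          ∀ l : ℝ, 0 < l →
            ENNReal.ofReal (c * δ * (⨆ x : E3, ‖b x‖) / l) ≤
              ⨆ x : E3,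
                (‖convK (fun z => ∫ y : E3, psil ψ l (z - y) * psil ψ l y) b x‖₊ : ℝ≥0∞) := by
  refine ⟨1 / 20, by norm_num, fun δ hδ b hb ⟨B, hB⟩ hsph l hl => ?_⟩
  obtain ⟨hδ0, hδ1⟩ := hδ
  obtain ⟨x₀, hx₀, hlow, hosc⟩ := hsph (4 * l / δ) (by positivity)
  set M := ⨆ x : E3, ‖b x‖
  have hM : 0 ≤ M := Real.iSup_nonneg fun _ => norm_nonneg _
  have hδx : δ * ‖x₀‖ = 4 * l := by rw [hx₀]; field_simp
  have hlδ : 2 * l ≤ l / δ := by rw [le_div_iff₀ hδ0]; nlinarith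
  have hx₀' : ‖x₀‖ = 4 * (l / δ) := by rw [hx₀]; ring
  have key := le_norm_convK (integral_psil_mul_psil_nonneg hψ hl)
    (integrable_integral_psil_mul_psil hψ hl) (integral_integral_psil_mul_psil hψ hl)
    (fun _ => integral_psil_mul_psil_eq_zero hψ hl) hb hB (x₀ := x₀) (r := M / 4)
    (by linarith) (by linarith) fun y hy =>
      hosc y (by rw [mem_ball_iff_norm, hδx]; linarith)
  refine le_iSup_of_le x₀ ?_
  rw [← enorm_eq_nnnorm, ← ofReal_norm]
  refine ENNReal.ofReal_le_ofReal (le_trans ?_ key)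
  calc 1 / 20 * δ * M / l = (5 * (l / δ))⁻¹ * (M / 4) := by field_simp; ring
    _ ≤ (‖x₀‖ + 2 * l)⁻¹ * (‖b x₀‖ - M / 4) := by
        exact mul_le_mul (inv_anti₀ (by positivity) (by linarith)) (by linarith) (by positivity)
          (by positivity)
end
end

section
/- Let 1 < q < p ≤ ∞ and α ∈ ℝ satisfy either −2/p < α < 1/q − 1/p, or p = ∞ and α = 0. There exists a constant C = C(p,q,α) such that the following holds for all M, N > 0. Let m : ℝ³ → ℂ be smooth with supp m ⊆ B(0,N) and |∇^j m(ξ)| ≤ M·N^{−j} for all ξ ∈ ℝ³ and all integers 0 ≤ j ≤ 100. Let u : ℝ³ → ℂ be a Schwartz function that is axisymmetric (u(Rx) = u(x) for every rotation R ∈ SO(3) fixing the x₃-axis), and define T_m u as the inverse Fourier transform of ξ ↦ m(ξ)·û(ξ). Then ‖r^α · T_m u‖_{L^p(ℝ³)} ≤ C·M·N^{3/q − 3/p − α}·‖u‖_{L^{q,∞}}. -/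
noncomputable section
open Real MeasureTheory Filter Metric Set
open scoped ENNReal NNReal Topology FourierTransform

/-- The polynomially decaying model kernel `(1 + |x|)⁻⁴`. -/
def decayKernel (x : E3) : ℝ≥0∞ := ENNReal.ofReal ((1 + ‖x‖) ^ (-(4 : ℝ)))

lemma measurable_decayKernel : Measurable decayKernel := by
  unfold decayKernel; fun_prop

lemma measurable_rr : Measurable rr := by
  unfold rr; fun_prop

lemma rr_nonneg (x : E3) : 0 ≤ rr x := Real.sqrt_nonneg _

lemma lintegral_decayKernel_lt_top : ∫⁻ x, decayKernel x < ∞ :=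
  finite_integral_one_add_norm (by simp; norm_num)

lemma integral_inv_one_add_mul_sq {c : ℝ} (hc : 0 ≤ c) {a : ℝ} (ha : 0 ≤ a) :
    ∫ t in (0 : ℝ)..a, ((1 + c * t) ^ 2)⁻¹ = a / (1 + c * a) := by
  have hpos : ∀ t ∈ uIcc 0 a, 0 < 1 + c * t := by
    intro t ht
    rw [uIcc_of_le ha] at ht
    have := mul_nonneg hc ht.1
    linarith
  have hderiv : ∀ t ∈ uIcc 0 a,
      HasDerivAt (fun t : ℝ => t / (1 + c * t)) (((1 + c * t) ^ 2)⁻¹) t := by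
    intro t ht
    have h := (hasDerivAt_id t).div (((hasDerivAt_id t).const_mul c).const_add 1) (hpos t ht).ne'
    refine h.congr_deriv ?_
    simp only [id]
    rw [inv_eq_one_div]
    congr 1
    ring
  rw [intervalIntegral.integral_eq_sub_of_hasDerivAt hderiv]
  · simp
  · refine ContinuousOn.intervalIntegrable ?_
    exact ContinuousOn.inv₀ (by fun_prop) fun t ht => by have := hpos t ht; positivity

lemma continuous_inv_one_add_mul_abs_sin_sq {r : ℝ} (hr : 0 ≤ r) :
    Continuous fun t : ℝ => ((1 + r * |sin t|) ^ 2)⁻¹ := by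
  refine Continuous.inv₀ (by fun_prop) fun t => by positivity

lemma integral_inv_one_add_mul_abs_sin_sq_le {r : ℝ} (hr : 0 ≤ r) (c : ℝ) :
    ∫ t in (0 : ℝ)..π, ((1 + r * |sin (t + c)|) ^ 2)⁻¹ ≤ π / (1 + r) := by
  have hcont := continuous_inv_one_add_mul_abs_sin_sq hr
  have hper : Function.Periodic (fun t : ℝ => ((1 + r * |sin t|) ^ 2)⁻¹) π := by
    intro t
    simp [Real.sin_add_pi]
  have hhalf : ∫ t in (0 : ℝ)..(π / 2), ((1 + r * |sin t|) ^ 2)⁻¹ ≤ (π / 2) / (1 + r) := by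
    have h := integral_inv_one_add_mul_sq (c := 2 / π * r) (by positivity) (a := π / 2)
      (by positivity)
    have he : 2 / π * r * (π / 2) = r := by field_simp
    rw [he] at h
    rw [← h]
    refine intervalIntegral.integral_mono_on (by positivity) (hcont.intervalIntegrable _ _) ?_ ?_
    · refine ContinuousOn.intervalIntegrable ?_
      refine ContinuousOn.inv₀ (by fun_prop) fun t ht => ?_
      rw [uIcc_of_le (by positivity)] at ht
      have := ht.1
      positivity
    · intro t ht
      have h0 := ht.1
      have hs : 2 / π * t ≤ sin t := Real.mul_le_sin ht.1 ht.2
      have hs0 : 0 ≤ sin t := le_trans (by positivity) hs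
      rw [abs_of_nonneg hs0]
      gcongr ?_⁻¹
      refine pow_le_pow_left₀ (by positivity) ?_ 2
      linarith [mul_le_mul_of_nonneg_left hs hr]
  rw [intervalIntegral.integral_comp_add_right (fun t => ((1 + r * |sin t|) ^ 2)⁻¹),
    zero_add, add_comm π c, hper.intervalIntegral_add_eq c (-(π / 2)),
    show -(π / 2) + π = π / 2 by ring,
    ← intervalIntegral.integral_add_adjacent_intervals (b := 0) (hcont.intervalIntegrable _ _)
      (hcont.intervalIntegrable _ _)]
  have hneg : ∫ t in (-(π / 2))..(0 : ℝ), ((1 + r * |sin t|) ^ 2)⁻¹ =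
      ∫ t in (0 : ℝ)..(π / 2), ((1 + r * |sin t|) ^ 2)⁻¹ := by
    have := intervalIntegral.integral_comp_neg (a := 0) (b := π / 2)
      (fun t : ℝ => ((1 + r * |sin t|) ^ 2)⁻¹)
    simp only [Real.sin_neg, abs_neg, neg_zero] at this
    exact this.symm
  rw [hneg]
  have : π / (1 + r) = (π / 2) / (1 + r) + (π / 2) / (1 + r) := by ring
  linarith

lemma exists_polar (a b : ℝ) :
    ∃ φ : ℝ, a = √(a ^ 2 + b ^ 2) * cos φ ∧ b = √(a ^ 2 + b ^ 2) * sin φ := by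
  have hn : ‖(⟨a, b⟩ : ℂ)‖ = √(a ^ 2 + b ^ 2) := by
    rw [Complex.norm_def, Complex.normSq_apply]; congr 1; simp; ring
  refine ⟨Complex.arg ⟨a, b⟩, ?_, ?_⟩
  · rw [← hn, Complex.norm_mul_cos_arg]
  · rw [← hn, Complex.norm_mul_sin_arg]

lemma rotZ_zero_apply (θ : ℝ) (x : E3) : rotZ θ x 0 = x 0 * cos θ - x 1 * sin θ := rfl
lemma rotZ_one_apply (θ : ℝ) (x : E3) : rotZ θ x 1 = x 0 * sin θ + x 1 * cos θ := rfl
lemma rotZ_two_apply (θ : ℝ) (x : E3) : rotZ θ x 2 = x 2 := rfl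

lemma exists_mul_abs_sin_le_norm_sub_rotZ (x y : E3) :
    ∃ c : ℝ, ∀ θ, rr x * |sin (θ + c)| ≤ ‖x - rotZ θ y‖ := by
  obtain ⟨a, ha0, ha1⟩ := exists_polar (x 0) (x 1)
  obtain ⟨b, hb0, hb1⟩ := exists_polar (y 0) (y 1)
  refine ⟨b - a, fun θ => ?_⟩
  rw [EuclideanSpace.norm_eq]
  apply Real.le_sqrt_of_sq_le
  change x 0 = rr x * cos a at ha0
  change x 1 = rr x * sin a at ha1
  change y 0 = rr y * cos b at hb0
  change y 1 = rr y * sin b at hb1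
  simp only [Fin.sum_univ_three, PiLp.sub_apply, rotZ_zero_apply, rotZ_one_apply, rotZ_two_apply,
    Real.norm_eq_abs, sq_abs, mul_pow]
  have h0 : y 0 * cos θ - y 1 * sin θ = rr y * cos (θ + b) := by
    rw [hb0, hb1, cos_add]; ring
  have h1 : y 0 * sin θ + y 1 * cos θ = rr y * sin (θ + b) := by
    rw [hb0, hb1, sin_add]; ring
  rw [h0, h1, show θ + (b - a) = (θ + b) - a by ring, sin_sub, ha0, ha1]
  set s := sin (θ + b)
  set k := cos (θ + b)
  have hsk : s ^ 2 + k ^ 2 = 1 := sin_sq_add_cos_sq _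
  set X := rr x * cos a - rr y * k
  set Y := rr x * sin a - rr y * s
  have key : rr x ^ 2 * (s * cos a - k * sin a) ^ 2 = (s * X - k * Y) ^ 2 := by
    simp only [X, Y]; ring
  rw [key]
  have h3 : X ^ 2 + Y ^ 2 = (s * X - k * Y) ^ 2 + (k * X + s * Y) ^ 2 := by
    calc X ^ 2 + Y ^ 2 = (s ^ 2 + k ^ 2) * (X ^ 2 + Y ^ 2) := by rw [hsk, one_mul]
      _ = _ := by ring
  nlinarith [sq_nonneg (k * X + s * Y), sq_nonneg (x 2 - y 2)]

lemma continuous_rotZ_uncurry : Continuous fun z : ℝ × E3 => rotZ z.1 z.2 := by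
  unfold rotZ
  refine (PiLp.continuous_toLp 2 _).comp ?_
  refine continuous_pi fun i => ?_
  fin_cases i <;> simp <;> fun_prop

/-- Rotation about the `x₃`-axis as a linear isometry. -/
def rotZIsometry (θ : ℝ) : E3 →ₗᵢ[ℝ] E3 where
  toFun := rotZ θ
  map_add' x y := by
    ext i
    fin_cases i <;> simp [rotZ] <;> ring
  map_smul' c x := by
    ext i
    fin_cases i <;> simp [rotZ] <;> ring
  norm_map' x := by
    simp only [LinearMap.coe_mk, AddHom.coe_mk, EuclideanSpace.norm_eq, Fin.sum_univ_three,
      rotZ_zero_apply, rotZ_one_apply, rotZ_two_apply, Real.norm_eq_abs, sq_abs]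
    congr 1
    linear_combination (x 0 ^ 2 + x 1 ^ 2) * sin_sq_add_cos_sq θ

lemma measurePreserving_rotZ (θ : ℝ) : MeasurePreserving (rotZ θ) :=
  ((rotZIsometry θ).toLinearIsometryEquiv rfl).measurePreserving

lemma lintegral_decayKernel_sub_rotZ_le (x y : E3) :
    ∫⁻ θ in Ioc 0 π, decayKernel (x - rotZ θ y) ≤ ENNReal.ofReal (π / (1 + rr x)) := by
  obtain ⟨c, hc⟩ := exists_mul_abs_sin_le_norm_sub_rotZ x y
  have hcont : Continuous fun t : ℝ => ((1 + rr x * |sin (t + c)|) ^ 2)⁻¹ :=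
    (continuous_inv_one_add_mul_abs_sin_sq (rr_nonneg x)).comp (continuous_add_const c)
  calc ∫⁻ θ in Ioc 0 π, decayKernel (x - rotZ θ y)
      ≤ ∫⁻ θ in Ioc 0 π, ENNReal.ofReal (((1 + rr x * |sin (θ + c)|) ^ 2)⁻¹) := by
        refine lintegral_mono fun θ => ENNReal.ofReal_le_ofReal ?_
        have h1 : 0 ≤ rr x * |sin (θ + c)| := mul_nonneg (rr_nonneg x) (abs_nonneg _)
        rw [Real.rpow_neg (by positivity)]
        gcongr ?_⁻¹
        calc (1 + rr x * |sin (θ + c)|) ^ 2 ≤ (1 + ‖x - rotZ θ y‖) ^ 2 := by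
              gcongr; exact hc θ
          _ ≤ (1 + ‖x - rotZ θ y‖) ^ 4 :=
              pow_le_pow_right₀ (by linarith [norm_nonneg (x - rotZ θ y)]) (by norm_num)
          _ = (1 + ‖x - rotZ θ y‖) ^ (4 : ℝ) := by norm_cast
    _ = ENNReal.ofReal (∫ t in (0 : ℝ)..π, ((1 + rr x * |sin (t + c)|) ^ 2)⁻¹) := by
        rw [intervalIntegral.integral_of_le pi_pos.le]
        rw [ofReal_integral_eq_lintegral_ofReal]
        · exact (hcont.integrableOn_Icc).mono_set Ioc_subset_Icc_self
        · exact Eventually.of_forall fun t => by positivity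
    _ ≤ _ := ENNReal.ofReal_le_ofReal (integral_inv_one_add_mul_abs_sin_sq_le (rr_nonneg x) c)

/-- Convolving an axisymmetric function with the decaying kernel gains a factor `(1 + r)⁻¹`. -/
lemma lintegral_decayKernel_mul_le {g : E3 → ℝ≥0∞} (hg : Measurable g)
    (hrot : ∀ θ x, g (rotZ θ x) = g x) (x : E3) :
    ∫⁻ y, decayKernel (x - y) * g y ≤ ENNReal.ofReal (1 / (1 + rr x)) * ∫⁻ y, g y := by
  have hk := measurable_decayKernel
  have hθ : ∀ θ, ∫⁻ y, decayKernel (x - rotZ θ y) * g y = ∫⁻ y, decayKernel (x - y) * g y := by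
    intro θ
    rw [← (measurePreserving_rotZ θ).lintegral_comp (f := fun y => decayKernel (x - y) * g y)
      (by fun_prop)]
    simp only [hrot]
  have hr := rr_nonneg x
  have hmain : ENNReal.ofReal π * ∫⁻ y, decayKernel (x - y) * g y ≤
      ENNReal.ofReal π * (ENNReal.ofReal (1 / (1 + rr x)) * ∫⁻ y, g y) := by
    calc ENNReal.ofReal π * ∫⁻ y, decayKernel (x - y) * g y
        = ∫⁻ _ in Ioc 0 π, ∫⁻ y, decayKernel (x - y) * g y := by
          rw [setLIntegral_const, Real.volume_Ioc, sub_zero, mul_comm]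
      _ = ∫⁻ θ in Ioc 0 π, ∫⁻ y, decayKernel (x - rotZ θ y) * g y := by simp only [hθ]
      _ = ∫⁻ y, ∫⁻ θ in Ioc 0 π, decayKernel (x - rotZ θ y) * g y := by
          refine lintegral_lintegral_swap (Measurable.aemeasurable ?_)
          have := continuous_rotZ_uncurry.measurable
          simp only [Function.uncurry_def]
          fun_prop
      _ = ∫⁻ y, (∫⁻ θ in Ioc 0 π, decayKernel (x - rotZ θ y)) * g y := by
          refine lintegral_congr fun y => lintegral_mul_const _ ?_
          have := continuous_rotZ_uncurry.measurable.comp (measurable_prodMk_right (y := y))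
          exact hk.comp (measurable_const.sub this)
      _ ≤ ∫⁻ y, ENNReal.ofReal (π / (1 + rr x)) * g y := by
          gcongr with y
          exact lintegral_decayKernel_sub_rotZ_le x y
      _ = _ := by
          rw [lintegral_const_mul _ hg, ← mul_assoc, ← ENNReal.ofReal_mul pi_pos.le, mul_one_div]
  exact (ENNReal.mul_le_mul_iff_right (by simpa using pi_pos) ENNReal.ofReal_ne_top).1 hmain

/-- Truncated power singularity on the line. -/
def truncPow (b : ℝ) (t : ℝ) : ℝ := (Icc (-1 : ℝ) 1).indicator (fun t => |t| ^ (-(b / 2))) t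

lemma truncPow_nonneg (b t : ℝ) : 0 ≤ truncPow b t :=
  indicator_nonneg (fun _ _ => by positivity) _

lemma integrable_truncPow {b : ℝ} (hb : b < 2) : Integrable (truncPow b) := by
  have h1 : IntegrableOn (fun t : ℝ => t ^ (-(b / 2))) (Icc 0 1) := by
    rw [integrableOn_Icc_iff_integrableOn_Ioc, ← intervalIntegrable_iff_integrableOn_Ioc_of_le
      zero_le_one]
    exact intervalIntegral.intervalIntegrable_rpow' (by linarith)
  have h2 : IntegrableOn (fun t : ℝ => |t| ^ (-(b / 2))) (Icc 0 1) :=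
    h1.congr_fun (fun t ht => by simp only [abs_of_nonneg ht.1]) measurableSet_Icc
  have h3 : IntegrableOn (fun t : ℝ => |t| ^ (-(b / 2))) (Icc (-1) 0) := by
    have := (integrableOn_Icc_iff_integrableOn_Ioc (μ := volume)).1 h2
    have h4 := (intervalIntegrable_iff_integrableOn_Ioc_of_le zero_le_one).2 this
    have h5 := (IntervalIntegrable.iff_comp_neg).1 h4
    simp only [abs_neg, neg_zero] at h5
    exact (integrableOn_Icc_iff_integrableOn_Ioc).2
      ((intervalIntegrable_iff_integrableOn_Ioc_of_le (by norm_num)).1 h5.symm)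
  have h6 := h3.union h2
  rw [Icc_union_Icc_eq_Icc (by norm_num) (by norm_num)] at h6
  exact h6.integrable_indicator measurableSet_Icc

lemma lintegral_truncPow_prod_lt_top {b : ℝ} (hb : b < 2) :
    ∫⁻ x : E3, ENNReal.ofReal (truncPow b (x 0) * truncPow b (x 1) * (1 + |x 2|) ^ (-(2 : ℝ)))
      < ∞ := by
  have hH : Integrable (fun t : ℝ => (1 + |t|) ^ (-(2 : ℝ))) :=
    integrable_one_add_norm (E := ℝ) (by simp)
  have hP : Integrable (fun x : Fin 3 → ℝ =>
      ∏ i, (![truncPow b, truncPow b, fun t : ℝ => (1 + |t|) ^ (-(2 : ℝ))] i) (x i)) := by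
    refine Integrable.fintype_prod fun i => ?_
    fin_cases i
    · exact integrable_truncPow hb
    · exact integrable_truncPow hb
    · exact hH
  have hE := (PiLp.volume_preserving_ofLp (Fin 3)).integrable_comp_of_integrable hP
  have := hE.lintegral_lt_top
  simpa [Function.comp_def, Fin.prod_univ_three] using this

lemma rr_rpow_mul_le {β γ : ℝ} (hγ : 0 ≤ γ) (hβγ : β ≤ γ) {x : E3} (h0 : x 0 ≠ 0) (h1 : x 1 ≠ 0) :
    rr x ^ β * (1 + rr x) ^ (-γ) ≤ 1 + truncPow (max 0 (-β)) (x 0) * truncPow (max 0 (-β)) (x 1) := by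
  have hr : 0 < rr x := by unfold rr; positivity
  have hT := mul_nonneg (truncPow_nonneg (max 0 (-β)) (x 0)) (truncPow_nonneg (max 0 (-β)) (x 1))
  have hrs : rr x ^ 2 = x 0 ^ 2 + x 1 ^ 2 := Real.sq_sqrt (by positivity)
  rcases le_or_gt 1 (rr x) with h | h
  · have : rr x ^ β * (1 + rr x) ^ (-γ) ≤ 1 := by
      calc rr x ^ β * (1 + rr x) ^ (-γ) ≤ rr x ^ γ * (rr x) ^ (-γ) := by
            refine mul_le_mul (Real.rpow_le_rpow_of_exponent_le h hβγ)
              (Real.rpow_le_rpow_of_nonpos hr (by linarith) (by linarith)) (by positivity)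
              (by positivity)
        _ = 1 := by rw [← Real.rpow_add hr]; simp
    linarith
  · have hb : 0 ≤ max 0 (-β) := le_max_left _ _
    have hbβ : -β ≤ max 0 (-β) := le_max_right _ _
    set b := max 0 (-β)
    have hx0 : |x 0| ≤ 1 := by rw [← sq_le_one_iff_abs_le_one]; nlinarith [sq_nonneg (x 1)]
    have hx1 : |x 1| ≤ 1 := by rw [← sq_le_one_iff_abs_le_one]; nlinarith [sq_nonneg (x 0)]
    have e0 : truncPow b (x 0) = |x 0| ^ (-(b / 2)) := indicator_of_mem (mem_Icc.2 (abs_le.1 hx0)) _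
    have e1 : truncPow b (x 1) = |x 1| ^ (-(b / 2)) := indicator_of_mem (mem_Icc.2 (abs_le.1 hx1)) _
    have hp0 := abs_pos.2 h0
    have hp1 := abs_pos.2 h1
    have : rr x ^ β * (1 + rr x) ^ (-γ) ≤ truncPow b (x 0) * truncPow b (x 1) := by
      calc rr x ^ β * (1 + rr x) ^ (-γ) ≤ rr x ^ (-b) * 1 := by
            refine mul_le_mul (Real.rpow_le_rpow_of_exponent_ge hr h.le (by linarith))
              (Real.rpow_le_one_of_one_le_of_nonpos (by linarith) (by linarith)) (by positivity)
              (by positivity)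
        _ = (rr x ^ 2) ^ (-(b / 2)) := by
            rw [mul_one, ← Real.rpow_natCast (rr x) 2, ← Real.rpow_mul hr.le]
            congr 1; push_cast; ring
        _ ≤ (|x 0| * |x 1|) ^ (-(b / 2)) := by
            refine Real.rpow_le_rpow_of_nonpos (by positivity) ?_ (by linarith)
            rw [hrs, ← sq_abs (x 0), ← sq_abs (x 1)]
            nlinarith [sq_nonneg (|x 0| - |x 1|)]
        _ = _ := by rw [Real.mul_rpow hp0.le hp1.le, e0, e1]
    linarith

lemma ae_coord_ne_zero (i : Fin 3) : ∀ᵐ x : E3, x i ≠ 0 := by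
  have h : ∀ᵐ x : Fin 3 → ℝ, x i ≠ 0 := Measure.ae_eval_ne (μ := fun _ : Fin 3 => (volume : Measure ℝ)) i 0
  exact (PiLp.volume_preserving_ofLp (Fin 3)).quasiMeasurePreserving.ae h

lemma decayKernel_le (x : E3) : decayKernel x ≤ ENNReal.ofReal ((1 + |x 2|) ^ (-(2 : ℝ))) := by
  refine ENNReal.ofReal_le_ofReal ?_
  have h2 : |x 2| ≤ ‖x‖ := PiLp.norm_apply_le x 2
  calc (1 + ‖x‖) ^ (-(4 : ℝ)) ≤ (1 + ‖x‖) ^ (-(2 : ℝ)) :=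
        Real.rpow_le_rpow_of_exponent_le (by linarith [norm_nonneg x]) (by norm_num)
    _ ≤ _ := Real.rpow_le_rpow_of_nonpos (by positivity) (by linarith) (by norm_num)

lemma measurable_truncPow (b : ℝ) : Measurable (truncPow b) := by
  unfold truncPow
  exact Measurable.indicator (by fun_prop) measurableSet_Icc

lemma exists_lintegral_weight_mul_decayKernel_le {β γ : ℝ} (hβ : -2 < β) (hγ : 0 ≤ γ)
    (hβγ : β ≤ γ) :
    ∃ C : ℝ≥0∞, C ≠ ∞ ∧ ∀ y, ∫⁻ x, ENNReal.ofReal (rr x ^ β * (1 + rr x) ^ (-γ)) *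
      decayKernel (x - y) ≤ C := by
  have hk := measurable_decayKernel
  set b := max 0 (-β) with hb
  have hb2 : b < 2 := max_lt (by norm_num) (by linarith)
  have hT := measurable_truncPow b
  refine ⟨(∫⁻ x, decayKernel x) + ∫⁻ x : E3, ENNReal.ofReal
    (truncPow b (x 0) * truncPow b (x 1) * (1 + |x 2|) ^ (-(2 : ℝ))),
    (ENNReal.add_lt_top.2 ⟨lintegral_decayKernel_lt_top, lintegral_truncPow_prod_lt_top hb2⟩).ne,
    fun y => ?_⟩
  calc ∫⁻ x, ENNReal.ofReal (rr x ^ β * (1 + rr x) ^ (-γ)) * decayKernel (x - y)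
      ≤ ∫⁻ x, (decayKernel (x - y) + ENNReal.ofReal
        (truncPow b (x 0) * truncPow b (x 1) * (1 + |x 2 - y 2|) ^ (-(2 : ℝ)))) := by
        refine lintegral_mono_ae ?_
        filter_upwards [ae_coord_ne_zero 0, ae_coord_ne_zero 1] with x h0 h1
        have hn := mul_nonneg (truncPow_nonneg b (x 0)) (truncPow_nonneg b (x 1))
        calc _ ≤ ENNReal.ofReal (1 + truncPow b (x 0) * truncPow b (x 1)) * decayKernel (x - y) := by
              gcongr; exact rr_rpow_mul_le hγ hβγ h0 h1
          _ = decayKernel (x - y) +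
              ENNReal.ofReal (truncPow b (x 0) * truncPow b (x 1)) * decayKernel (x - y) := by
              rw [ENNReal.ofReal_add zero_le_one hn, ENNReal.ofReal_one, add_mul, one_mul]
          _ ≤ _ := by
              rw [ENNReal.ofReal_mul hn]
              gcongr
              exact decayKernel_le (x - y)
    _ = (∫⁻ x, decayKernel (x - y)) + ∫⁻ x : E3, ENNReal.ofReal
        (truncPow b (x 0) * truncPow b (x 1) * (1 + |x 2 - y 2|) ^ (-(2 : ℝ))) :=
        lintegral_add_left (by fun_prop) _
    _ = _ := by
        congr 1
        · exact lintegral_sub_right_eq_self _ y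
        · have := lintegral_sub_right_eq_self (μ := (volume : Measure E3)) (fun x : E3 =>
            ENNReal.ofReal (truncPow b (x 0) * truncPow b (x 1) * (1 + |x 2|) ^ (-(2 : ℝ))))
            (EuclideanSpace.single 2 (y 2))
          simpa using this

lemma lintegral_decayKernel_sub (x : E3) : ∫⁻ y, decayKernel (x - y) = ∫⁻ y, decayKernel y :=
  lintegral_sub_left_eq_self _ x

lemma lintegral_decayKernel_mul_le_rpow {s : ℝ} (hs : 1 ≤ s) {f : E3 → ℝ≥0∞} (hf : Measurable f)
    (x : E3) :
    ∫⁻ y, decayKernel (x - y) * f y ≤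
      (∫⁻ y, decayKernel (x - y) * f y ^ s) ^ (1 / s) * (∫⁻ y, decayKernel y) ^ (1 - 1 / s) := by
  have hk : Measurable fun y => decayKernel (x - y) :=
    measurable_decayKernel.comp (measurable_const.sub measurable_id)
  have h := eLpNorm'_le_eLpNorm'_mul_rpow_measure_univ
    (μ := volume.withDensity fun y => decayKernel (x - y)) zero_lt_one hs
    hf.aestronglyMeasurable
  simp only [eLpNorm'_eq_lintegral_enorm, enorm_eq_self, ENNReal.rpow_one, div_one] at h
  rw [withDensity_apply _ MeasurableSet.univ, Measure.restrict_univ, lintegral_decayKernel_sub,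
    lintegral_withDensity_eq_lintegral_mul _ hk hf,
    lintegral_withDensity_eq_lintegral_mul _ hk (hf.pow_const s)] at h
  exact h

lemma measurable_lintegral_decayKernel_mul {f : E3 → ℝ≥0∞} (hf : Measurable f) :
    Measurable fun x => ∫⁻ y, decayKernel (x - y) * f y := by
  have := measurable_decayKernel
  refine Measurable.lintegral_prod_right' (f := fun z : E3 × E3 => decayKernel (z.1 - z.2) * f z.2) ?_
  fun_prop

lemma lintegral_weight_rpow_le {P s α : ℝ} (hs : 1 ≤ s) (hsP : s ≤ P) (hα : α ≤ 1 / s - 1 / P)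
    (hα' : -2 / P < α) {A : ℝ≥0∞} (hA : A ≠ ∞) :
    ∃ C : ℝ≥0∞, C ≠ ∞ ∧ ∀ f : E3 → ℝ≥0∞, Measurable f → (∀ θ x, f (rotZ θ x) = f x) →
      ∫⁻ y, f y ^ s ≤ A →
      ∫⁻ x, (ENNReal.ofReal (rr x ^ α) * ∫⁻ y, decayKernel (x - y) * f y) ^ P ≤ C := by
  have hs0 : 0 < s := by linarith
  have hP0 : 0 < P := by linarith
  set γ := P / s - 1 with hγdef
  have hγ : 0 ≤ γ := by
    have : 1 ≤ P / s := (one_le_div hs0).2 hsP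
    linarith
  have hβ : -2 < α * P := (div_lt_iff₀ hP0).1 hα'
  have hβγ : α * P ≤ γ := by
    calc α * P ≤ (1 / s - 1 / P) * P := by gcongr
      _ = γ := by rw [hγdef]; field_simp
  obtain ⟨C₂, hC₂, hC₂'⟩ := exists_lintegral_weight_mul_decayKernel_le hβ hγ hβγ
  have hk := measurable_decayKernel
  set K := (∫⁻ y, decayKernel y) ^ (1 - 1 / s)
  have hs1 : 0 ≤ 1 - 1 / s := by
    have : 1 / s ≤ 1 := (div_le_one hs0).2 hs
    linarith
  have hK : K ≠ ∞ := ENNReal.rpow_ne_top_of_nonneg hs1 lintegral_decayKernel_lt_top.ne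
  refine ⟨K ^ P * A ^ γ * (A * C₂), ?_, fun f hf hrot hfA => ?_⟩
  · exact ENNReal.mul_ne_top (ENNReal.mul_ne_top (ENNReal.rpow_ne_top_of_nonneg hP0.le hK)
      (ENNReal.rpow_ne_top_of_nonneg hγ hA)) (ENNReal.mul_ne_top hA hC₂)
  have hfs : Measurable fun y => f y ^ s := hf.pow_const s
  have hB := measurable_lintegral_decayKernel_mul hfs
  have hrr := measurable_rr
  have hpt : ∀ x, (ENNReal.ofReal (rr x ^ α) * ∫⁻ y, decayKernel (x - y) * f y) ^ P ≤
      K ^ P * A ^ γ * (ENNReal.ofReal (rr x ^ (α * P) * (1 + rr x) ^ (-γ)) *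
        ∫⁻ y, decayKernel (x - y) * f y ^ s) := by
    intro x
    have hr := rr_nonneg x
    set B := ∫⁻ y, decayKernel (x - y) * f y ^ s with hBdef
    have hB1 : B ≤ ENNReal.ofReal (1 / (1 + rr x)) * A :=
      (lintegral_decayKernel_mul_le hfs (fun θ x => by rw [hrot]) x).trans (by gcongr)
    calc (ENNReal.ofReal (rr x ^ α) * ∫⁻ y, decayKernel (x - y) * f y) ^ P
        ≤ (ENNReal.ofReal (rr x ^ α) * (B ^ (1 / s) * K)) ^ P := by
          gcongr
          exact lintegral_decayKernel_mul_le_rpow hs hf x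
      _ = ENNReal.ofReal (rr x ^ (α * P)) * (B ^ (γ + 1) * K ^ P) := by
          rw [ENNReal.mul_rpow_of_nonneg _ _ hP0.le, ENNReal.mul_rpow_of_nonneg _ _ hP0.le,
            ENNReal.ofReal_rpow_of_nonneg (by positivity) hP0.le, ← Real.rpow_mul hr,
            ← ENNReal.rpow_mul]
          congr 3
          rw [hγdef]; ring
      _ ≤ ENNReal.ofReal (rr x ^ (α * P)) *
          (((ENNReal.ofReal (1 / (1 + rr x)) * A) ^ γ * B) * K ^ P) := by
          rw [ENNReal.rpow_add_of_nonneg _ _ hγ zero_le_one, ENNReal.rpow_one]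
          gcongr
      _ = _ := by
          rw [ENNReal.mul_rpow_of_nonneg _ _ hγ, ENNReal.ofReal_rpow_of_nonneg (by positivity) hγ,
            ENNReal.ofReal_mul (by positivity), one_div, Real.inv_rpow (by positivity),
            ← Real.rpow_neg (by positivity)]
          ring
  calc _ ≤ ∫⁻ x, K ^ P * A ^ γ * (ENNReal.ofReal (rr x ^ (α * P) * (1 + rr x) ^ (-γ)) *
        ∫⁻ y, decayKernel (x - y) * f y ^ s) := lintegral_mono hpt
    _ = K ^ P * A ^ γ * ∫⁻ x, (ENNReal.ofReal (rr x ^ (α * P) * (1 + rr x) ^ (-γ)) *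
        ∫⁻ y, decayKernel (x - y) * f y ^ s) := lintegral_const_mul _ (by fun_prop)
    _ = K ^ P * A ^ γ * ∫⁻ x, ∫⁻ y, ENNReal.ofReal (rr x ^ (α * P) * (1 + rr x) ^ (-γ)) *
        (decayKernel (x - y) * f y ^ s) := by
        congr 1
        refine lintegral_congr fun x => (lintegral_const_mul _ ?_).symm
        fun_prop
    _ = K ^ P * A ^ γ * ∫⁻ y, ∫⁻ x, ENNReal.ofReal (rr x ^ (α * P) * (1 + rr x) ^ (-γ)) *
        (decayKernel (x - y) * f y ^ s) := by
        congr 1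
        refine lintegral_lintegral_swap (Measurable.aemeasurable ?_)
        simp only [Function.uncurry_def]
        fun_prop
    _ = K ^ P * A ^ γ * ∫⁻ y, f y ^ s * ∫⁻ x, ENNReal.ofReal (rr x ^ (α * P) * (1 + rr x) ^ (-γ)) *
        decayKernel (x - y) := by
        congr 1
        refine lintegral_congr fun y => ?_
        rw [← lintegral_const_mul _ (by fun_prop)]
        exact lintegral_congr fun x => by ring
    _ ≤ K ^ P * A ^ γ * ∫⁻ y, f y ^ s * C₂ := by
        gcongr with y
        exact hC₂' y
    _ ≤ K ^ P * A ^ γ * (A * C₂) := by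
        rw [lintegral_mul_const _ hfs]
        gcongr

lemma weight_mul_lintegral_le {s α : ℝ} (hs : 1 ≤ s) (hα0 : 0 ≤ α) (hα : α ≤ 1 / s) {A : ℝ≥0∞}
    {f : E3 → ℝ≥0∞} (hf : Measurable f) (hrot : ∀ θ x, f (rotZ θ x) = f x)
    (hfA : ∫⁻ y, f y ^ s ≤ A) (x : E3) :
    ENNReal.ofReal (rr x ^ α) * ∫⁻ y, decayKernel (x - y) * f y ≤
      A ^ (1 / s) * (∫⁻ y, decayKernel y) ^ (1 - 1 / s) := by
  have hs0 : 0 < s := by linarith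
  have hr := rr_nonneg x
  have hB1 : ∫⁻ y, decayKernel (x - y) * f y ^ s ≤ ENNReal.ofReal (1 / (1 + rr x)) * A :=
    (lintegral_decayKernel_mul_le (hf.pow_const s) (fun θ x => by rw [hrot]) x).trans (by gcongr)
  calc _ ≤ ENNReal.ofReal (rr x ^ α) * ((ENNReal.ofReal (1 / (1 + rr x)) * A) ^ (1 / s) *
        (∫⁻ y, decayKernel y) ^ (1 - 1 / s)) := by
        gcongr
        refine (lintegral_decayKernel_mul_le_rpow hs hf x).trans ?_
        gcongr
    _ = ENNReal.ofReal (rr x ^ α * (1 + rr x) ^ (-(1 / s))) *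
        (A ^ (1 / s) * (∫⁻ y, decayKernel y) ^ (1 - 1 / s)) := by
        rw [ENNReal.mul_rpow_of_nonneg _ _ (by positivity),
          ENNReal.ofReal_rpow_of_nonneg (by positivity) (by positivity),
          ENNReal.ofReal_mul (by positivity), one_div (1 + rr x), Real.inv_rpow (by positivity),
          ← Real.rpow_neg (by positivity)]
        ring
    _ ≤ 1 * (A ^ (1 / s) * (∫⁻ y, decayKernel y) ^ (1 - 1 / s)) := by
        gcongr
        rw [ENNReal.ofReal_le_one]
        calc rr x ^ α * (1 + rr x) ^ (-(1 / s))
            ≤ (1 + rr x) ^ (1 / s) * (1 + rr x) ^ (-(1 / s)) := by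
              gcongr
              exact (Real.rpow_le_rpow hr (by linarith) hα0).trans
                (Real.rpow_le_rpow_of_exponent_le (by linarith) hα)
          _ = 1 := by rw [← Real.rpow_add (by linarith)]; simp
    _ = _ := one_mul _

/-- Weighted strong-type bound for the decaying kernel on axisymmetric functions. -/
lemma exists_eLpNorm_weight_le_of_lintegral_le {p : ℝ≥0∞} {s α : ℝ} (hs : 1 ≤ s)
    (hsp : ENNReal.ofReal s ≤ p) (hα : α ≤ 1 / s - 1 / p.toReal)
    (hα' : p ≠ ∞ → -2 / p.toReal < α) (hα'' : p = ∞ → 0 ≤ α) {A : ℝ≥0∞} (hA : A ≠ ∞) :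
    ∃ C : ℝ≥0∞, C ≠ ∞ ∧ ∀ f : E3 → ℝ≥0∞, Measurable f → (∀ θ x, f (rotZ θ x) = f x) →
      ∫⁻ y, f y ^ s ≤ A →
      eLpNorm (fun x => ENNReal.ofReal (rr x ^ α) * ∫⁻ y, decayKernel (x - y) * f y) p volume
        ≤ C := by
  have hs0 : 0 < s := by linarith
  rcases eq_or_ne p ∞ with rfl | hp
  · have hs1 : 0 ≤ 1 - 1 / s := by
      have : 1 / s ≤ 1 := (div_le_one hs0).2 hs
      linarith
    refine ⟨A ^ (1 / s) * (∫⁻ y, decayKernel y) ^ (1 - 1 / s), ENNReal.mul_ne_top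
      (ENNReal.rpow_ne_top_of_nonneg (by positivity) hA)
      (ENNReal.rpow_ne_top_of_nonneg hs1 lintegral_decayKernel_lt_top.ne), fun f hf hrot hfA => ?_⟩
    rw [eLpNorm_exponent_top]
    refine essSup_le_of_ae_le _ (Eventually.of_forall fun x => ?_)
    exact weight_mul_lintegral_le hs (hα'' rfl) (by simpa using hα) hf hrot hfA x
  · have hsP : s ≤ p.toReal := (ENNReal.ofReal_le_iff_le_toReal hp).1 hsp
    obtain ⟨C, hC, hC'⟩ := lintegral_weight_rpow_le hs hsP hα (hα' hp) hA
    have hP0 : 0 < p.toReal := by linarith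
    refine ⟨C ^ (1 / p.toReal), ENNReal.rpow_ne_top_of_nonneg (by positivity) hC,
      fun f hf hrot hfA => ?_⟩
    rw [eLpNorm_eq_lintegral_rpow_enorm_toReal (ENNReal.toReal_pos_iff.1 hP0).1.ne' hp]
    gcongr
    exact hC' f hf hrot hfA

lemma lintegral_rpow_le_of_meas_le {q s : ℝ} (hs : 0 < s) {f : E3 → ℝ}
    (hf : Measurable f) (hf0 : ∀ x, 0 ≤ f x) (hf1 : ∀ x, f x ≤ 1)
    (hw : ∀ t, 0 < t → volume {x | t ≤ f x} ≤ ENNReal.ofReal (t ^ (-q))) :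
    ∫⁻ x, ENNReal.ofReal (f x ^ s) ≤
      ENNReal.ofReal s * ∫⁻ t in Ioc (0 : ℝ) 1, ENNReal.ofReal (t ^ (s - 1 - q)) := by
  rw [lintegral_rpow_eq_lintegral_meas_le_mul volume (Eventually.of_forall hf0) hf.aemeasurable hs]
  refine mul_le_mul' le_rfl ?_
  rw [← lintegral_indicator measurableSet_Ioi, ← lintegral_indicator measurableSet_Ioc]
  refine lintegral_mono fun t => ?_
  by_cases h0 : 0 < t
  · rw [indicator_of_mem (mem_Ioi.2 h0)]
    by_cases h1 : t ≤ 1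
    · rw [indicator_of_mem (mem_Ioc.2 ⟨h0, h1⟩)]
      calc _ ≤ ENNReal.ofReal (t ^ (-q)) * ENNReal.ofReal (t ^ (s - 1)) := by
            gcongr; exact hw t h0
        _ = _ := by
            rw [← ENNReal.ofReal_mul (by positivity), ← Real.rpow_add h0]
            congr 2; ring
    · have : {x | t ≤ f x} = ∅ := by
        ext x
        simpa using (hf1 x).trans_lt (not_le.1 h1)
      simp [this]
  · rw [indicator_of_notMem (by simpa using h0)]
    exact zero_le

lemma lintegral_le_of_meas_le {q : ℝ} {f : E3 → ℝ}
    (hf : Measurable f) (hf0 : ∀ x, 0 ≤ f x) (hf1 : ∀ x, f x = 0 ∨ 1 < f x)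
    (hw : ∀ t, 0 < t → volume {x | t ≤ f x} ≤ ENNReal.ofReal (t ^ (-q))) :
    ∫⁻ x, ENNReal.ofReal (f x) ≤ 1 + ∫⁻ t in Ioi (1 : ℝ), ENNReal.ofReal (t ^ (-q)) := by
  rw [lintegral_eq_lintegral_meas_le volume (Eventually.of_forall hf0) hf.aemeasurable,
    ← Ioc_union_Ioi_eq_Ioi (zero_le_one' ℝ)]
  refine (lintegral_union_le _ _ _).trans ?_
  gcongr ?_ + ?_
  · calc _ ≤ ∫⁻ _ in Ioc (0 : ℝ) 1, 1 := by
          refine setLIntegral_mono measurable_const fun t ht => ?_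
          calc volume {x | t ≤ f x} ≤ volume {x | 1 ≤ f x} := by
                refine measure_mono fun x (hx : t ≤ f x) => ?_
                rcases hf1 x with h | h
                · linarith [ht.1]
                · exact h.le
            _ ≤ 1 := by simpa using hw 1 one_pos
      _ = 1 := by simp
  · exact setLIntegral_mono (by fun_prop) fun t ht => hw t (one_pos.trans ht)

lemma exists_interpolation_exponent {q : ℝ} {p : ℝ≥0∞} {α : ℝ} (hq : 0 < q)
    (hqp : ENNReal.ofReal q < p) (hα : α < 1 / q - 1 / p.toReal) :
    ∃ s, q < s ∧ ENNReal.ofReal s ≤ p ∧ α ≤ 1 / s - 1 / p.toReal := by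
  have hp : 1 / p.toReal < 1 / q := by
    rcases eq_or_ne p ∞ with rfl | hp
    · simpa using hq
    · have : q < p.toReal := (ENNReal.ofReal_lt_iff_lt_toReal hq.le hp).1 hqp
      exact one_div_lt_one_div_of_lt hq this
  have hp0 : 0 ≤ 1 / p.toReal := by positivity
  set m := max (α + 1 / p.toReal) (1 / p.toReal) with hm
  have hm1 : m < 1 / q := max_lt (by linarith) hp
  have hm2 : α + 1 / p.toReal ≤ m := le_max_left _ _
  have hm3 : 1 / p.toReal ≤ m := le_max_right _ _
  set τ := (1 / q + m) / 2 with hτ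
  have hτ0 : 0 < τ := by linarith
  refine ⟨1 / τ, ?_, ?_, ?_⟩
  · rw [lt_one_div hq hτ0]; linarith
  · rcases eq_or_ne p ∞ with rfl | hpt
    · exact le_top
    · rw [ENNReal.ofReal_le_iff_le_toReal hpt]
      have hP : 0 < p.toReal := hq.trans ((ENNReal.ofReal_lt_iff_lt_toReal hq.le hpt).1 hqp)
      rw [one_div_le hτ0 hP]; linarith
  · rw [one_div_one_div]; linarith

/-- Weighted bound for the decaying kernel on axisymmetric functions in the unit ball of weak
`L^q`. -/
lemma exists_eLpNorm_weight_le_of_meas_le {q : ℝ} {p : ℝ≥0∞} {α : ℝ} (hq : 1 < q)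
    (hqp : ENNReal.ofReal q < p) (hα : α < 1 / q - 1 / p.toReal)
    (hα' : p ≠ ∞ → -2 / p.toReal < α) (hα'' : p = ∞ → 0 ≤ α) :
    ∃ C : ℝ≥0∞, C ≠ ∞ ∧ ∀ f : E3 → ℝ, Measurable f → (∀ x, 0 ≤ f x) →
      (∀ θ x, f (rotZ θ x) = f x) →
      (∀ t, 0 < t → volume {x | t ≤ f x} ≤ ENNReal.ofReal (t ^ (-q))) →
      eLpNorm (fun x => ENNReal.ofReal (rr x ^ α) *
        ∫⁻ y, decayKernel (x - y) * ENNReal.ofReal (f y)) p volume ≤ C := by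
  obtain ⟨s, hqs, hsp, hαs⟩ := exists_interpolation_exponent (by linarith) hqp hα
  have hp1 : ENNReal.ofReal 1 ≤ p := (ENNReal.ofReal_le_ofReal hq.le).trans hqp.le
  have hs0 : 0 < s := by linarith
  have hα1 : α ≤ 1 / 1 - 1 / p.toReal := by
    have : 1 / q ≤ 1 := (div_le_one (by linarith)).2 hq.le
    linarith
  have hA1 : 1 + ∫⁻ t in Ioi (1 : ℝ), ENNReal.ofReal (t ^ (-q)) ≠ ∞ :=
    (ENNReal.add_lt_top.2 ⟨ENNReal.one_lt_top,
      (integrableOn_Ioi_rpow_of_lt (by linarith) one_pos).lintegral_lt_top⟩).ne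
  have hA2 : ENNReal.ofReal s * ∫⁻ t in Ioc (0 : ℝ) 1, ENNReal.ofReal (t ^ (s - 1 - q)) ≠ ∞ := by
    refine ENNReal.mul_ne_top ENNReal.ofReal_ne_top (Integrable.lintegral_lt_top ?_).ne
    exact (intervalIntegrable_iff_integrableOn_Ioc_of_le zero_le_one).1
      (intervalIntegral.intervalIntegrable_rpow' (by linarith))
  obtain ⟨C₁, hC₁, h₁⟩ := exists_eLpNorm_weight_le_of_lintegral_le le_rfl hp1 hα1 hα' hα'' hA1
  obtain ⟨C₂, hC₂, h₂⟩ := exists_eLpNorm_weight_le_of_lintegral_le (by linarith) hsp hαs hα' hα''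
    hA2
  refine ⟨C₁ + C₂, ENNReal.add_ne_top.2 ⟨hC₁, hC₂⟩, fun f hf hf0 hrot hw => ?_⟩
  set f₁ : E3 → ℝ := fun x => if 1 < f x then f x else 0 with hf₁
  set f₂ : E3 → ℝ := fun x => if 1 < f x then 0 else f x with hf₂
  have hset : MeasurableSet {x | 1 < f x} := measurableSet_lt measurable_const hf
  have hm₁ : Measurable f₁ := Measurable.ite hset hf measurable_const
  have hm₂ : Measurable f₂ := Measurable.ite hset measurable_const hf
  have hf₁0 : ∀ x, 0 ≤ f₁ x := fun x => by
    simp only [hf₁]; split_ifs <;> simp [hf0]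
  have hf₂0 : ∀ x, 0 ≤ f₂ x := fun x => by
    simp only [hf₂]; split_ifs <;> simp [hf0]
  have hle₁ : ∀ x, f₁ x ≤ f x := fun x => by
    simp only [hf₁]; split_ifs <;> simp [hf0]
  have hle₂ : ∀ x, f₂ x ≤ f x := fun x => by
    simp only [hf₂]; split_ifs <;> simp [hf0]
  have hsum : ∀ x, ENNReal.ofReal (f x) = ENNReal.ofReal (f₁ x) + ENNReal.ofReal (f₂ x) :=
    fun x => by simp only [hf₁, hf₂]; split_ifs <;> simp
  have hb₁ := lintegral_le_of_meas_le hm₁ hf₁0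
    (fun x => by simp only [hf₁]; split_ifs with h <;> simp [h])
    (fun t ht => (measure_mono fun x (hx : t ≤ f₁ x) => hx.trans (hle₁ x)).trans (hw t ht))
  have hb₂ := lintegral_rpow_le_of_meas_le hs0 hm₂ hf₂0
    (fun x => by simp only [hf₂]; split_ifs with h <;> simp [not_lt.1, *])
    (fun t ht => (measure_mono fun x (hx : t ≤ f₂ x) => hx.trans (hle₂ x)).trans (hw t ht))
  have hk := measurable_decayKernel
  have hrr := measurable_rr
  have hM₁ := measurable_lintegral_decayKernel_mul hm₁.ennreal_ofReal
  have hM₂ := measurable_lintegral_decayKernel_mul hm₂.ennreal_ofReal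
  have hsplit : (fun x => ENNReal.ofReal (rr x ^ α) *
        ∫⁻ y, decayKernel (x - y) * ENNReal.ofReal (f y)) =
      (fun x => ENNReal.ofReal (rr x ^ α) *
        ∫⁻ y, decayKernel (x - y) * ENNReal.ofReal (f₁ y)) +
      (fun x => ENNReal.ofReal (rr x ^ α) *
        ∫⁻ y, decayKernel (x - y) * ENNReal.ofReal (f₂ y)) := by
    funext x
    simp only [Pi.add_apply, hsum, mul_add]
    rw [lintegral_add_left (by fun_prop), mul_add]
  rw [hsplit]
  refine (eLpNorm_add_le (Measurable.aestronglyMeasurable (by fun_prop))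
    (Measurable.aestronglyMeasurable (by fun_prop)) (by simpa using hp1)).trans ?_
  gcongr
  · refine h₁ _ hm₁.ennreal_ofReal (fun θ x => by simp only [hf₁, hrot]) ?_
    simpa using hb₁
  · refine h₂ _ hm₂.ennreal_ofReal (fun θ x => by simp only [hf₂, hrot]) ?_
    simpa only [ENNReal.ofReal_rpow_of_nonneg (hf₂0 _) hs0.le] using hb₂

lemma exists_eLpNorm_weight_le_wnorm' {q : ℝ} {p : ℝ≥0∞} {α : ℝ} (hq : 1 < q)
    (hqp : ENNReal.ofReal q < p) (hα : α < 1 / q - 1 / p.toReal)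
    (hα' : p ≠ ∞ → -2 / p.toReal < α) (hα'' : p = ∞ → 0 ≤ α) :
    ∃ C : ℝ≥0∞, C ≠ ∞ ∧ C ≠ 0 ∧ ∀ v : E3 → ℂ, Measurable v →
      (∀ θ x, v (rotZ θ x) = v x) →
      eLpNorm (fun x => ENNReal.ofReal (rr x ^ α) * ∫⁻ y, decayKernel (x - y) * ‖v y‖ₑ) p volume
        ≤ C * wnorm' v q := by
  obtain ⟨C₀, hC₀, h⟩ := exists_eLpNorm_weight_le_of_meas_le hq hqp hα hα' hα''
  set C := C₀ + 1
  have hC : C ≠ ∞ := ENNReal.add_ne_top.2 ⟨hC₀, ENNReal.one_ne_top⟩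
  have hC0 : C ≠ 0 := by simp [C]
  refine ⟨C, hC, hC0, fun v hv hrot => ?_⟩
  rcases eq_or_ne (wnorm' v q) ∞ with hw | hw
  · rw [hw, ENNReal.mul_top hC0]; exact le_top
  have key : ∀ W : ℝ≥0, 0 < W → wnorm' v q ≤ W →
      eLpNorm (fun x => ENNReal.ofReal (rr x ^ α) * ∫⁻ y, decayKernel (x - y) * ‖v y‖ₑ) p volume
        ≤ C * W := by
    intro W hW hvW
    have hW' : (0 : ℝ) < W := hW
    have hf := h (fun x => ‖v x‖ / W) (hv.norm.div_const _) (fun x => by positivity)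
      (fun θ x => by rw [hrot]) (by
        intro t ht
        have h1 : ENNReal.ofReal (t * W) * volume {x : E3 | t * W ≤ ‖v x‖} ^ (1 / q) ≤ W :=
          (le_iSup₂ (f := fun (l : ℝ) (_ : 0 < l) =>
            ENNReal.ofReal l * volume {x : E3 | l ≤ ‖v x‖} ^ (1 / q)) (t * W)
            (by positivity)).trans hvW
        have hq0 : 0 < q := by linarith
        have hset : {x | t ≤ ‖v x‖ / W} = {x : E3 | t * W ≤ ‖v x‖} := by
          ext x; simp only [mem_ofPred_eq, le_div_iff₀ hW']
        rw [hset]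
        set V := volume {x : E3 | t * W ≤ ‖v x‖}
        have h2 : V ^ (1 / q) ≤ ENNReal.ofReal t⁻¹ := by
          have h3 : ENNReal.ofReal (t * W) * V ^ (1 / q) ≤
              ENNReal.ofReal (t * W) * ENNReal.ofReal t⁻¹ := by
            rw [← ENNReal.ofReal_mul (by positivity)]
            refine h1.trans_eq ?_
            rw [show t * W * t⁻¹ = W by field_simp, ENNReal.ofReal_coe_nnreal]
          exact (ENNReal.mul_le_mul_iff_right (by simp; positivity) ENNReal.ofReal_ne_top).1 h3
        calc V = (V ^ (1 / q)) ^ q := by rw [← ENNReal.rpow_mul]; field_simp; simp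
          _ ≤ (ENNReal.ofReal t⁻¹) ^ q := by gcongr
          _ = _ := by
            rw [ENNReal.ofReal_rpow_of_nonneg (by positivity) hq0.le, Real.inv_rpow ht.le,
              Real.rpow_neg ht.le])
    have hmono := eLpNorm_le_nnreal_smul_eLpNorm_of_ae_le_mul' (μ := (volume : Measure E3)) (c := W)
      (f := fun x => ENNReal.ofReal (rr x ^ α) * ∫⁻ y, decayKernel (x - y) * ‖v y‖ₑ)
      (g := fun x => ENNReal.ofReal (rr x ^ α) *
        ∫⁻ y, decayKernel (x - y) * ENNReal.ofReal (‖v y‖ / W)) (Eventually.of_forall fun x => by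
        have hk := measurable_decayKernel
        simp only [enorm_eq_self]
        rw [mul_left_comm (W : ℝ≥0∞), ← lintegral_const_mul (W : ℝ≥0∞) (by fun_prop)]
        refine mul_le_mul' le_rfl (lintegral_mono fun y => le_of_eq ?_)
        rw [mul_left_comm, ← ENNReal.ofReal_coe_nnreal, ← ENNReal.ofReal_mul W.coe_nonneg,
          mul_div_cancel₀ _ hW'.ne', ofReal_norm]) p
    refine hmono.trans ?_
    rw [ENNReal.smul_def, smul_eq_mul, mul_comm]
    gcongr
    exact hf.trans le_self_add
  refine ENNReal.le_of_forall_pos_le_add fun ε hε _ => ?_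
  have hCn : C.toNNReal ≠ 0 := (ENNReal.toNNReal_ne_zero).2 ⟨hC0, hC⟩
  have hδ : 0 < ε / C.toNNReal := div_pos hε (pos_iff_ne_zero.2 hCn)
  refine (key ((wnorm' v q).toNNReal + ε / C.toNNReal) (by positivity) ?_).trans ?_
  · rw [ENNReal.coe_add, ENNReal.coe_toNNReal hw]; exact le_self_add
  · rw [ENNReal.coe_add, ENNReal.coe_toNNReal hw, mul_add]
    gcongr
    rw [← ENNReal.coe_toNNReal hC, ← ENNReal.coe_mul]
    simp only [ENNReal.toNNReal_coe]
    rw [mul_div_cancel₀ _ hCn]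

/-- The Fourier transform of a smooth function supported in the unit ball decays polynomially. -/
lemma pow_mul_norm_fourier_le {M : ℝ} {m : E3 → ℂ} (hm : ContDiff ℝ (⊤ : ℕ∞) m)
    (hsupp : tsupport m ⊆ ball 0 1) (n : ℕ)
    (hM : ∀ ξ, ∀ j ≤ n, ‖iteratedFDeriv ℝ j m ξ‖ ≤ M) (w : E3) :
    ‖w‖ ^ n * ‖𝓕 m w‖ ≤ 2 ^ n * ((n + 1) * (M * volume.real (ball (0 : E3) 1))) := by
  have hcs : HasCompactSupport m :=
    HasCompactSupport.of_support_subset_isCompact (isCompact_closedBall (0 : E3) 1)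
      ((subset_tsupport m).trans (hsupp.trans ball_subset_closedBall))
  have hcont : ∀ j : ℕ, Continuous (iteratedFDeriv ℝ j m) := fun j =>
    hm.continuous_iteratedFDeriv (by exact_mod_cast le_top)
  have hint : ∀ j : ℕ, Integrable (fun v => ‖iteratedFDeriv ℝ j m v‖) := fun j =>
    ((hcont j).integrable_of_hasCompactSupport (hcs.iteratedFDeriv j)).norm
  have hbound : ∀ j ≤ n, ∫ v, ‖iteratedFDeriv ℝ j m v‖ ≤ M * volume.real (ball (0 : E3) 1) := by
    intro j hj
    have hz : ∀ v ∉ ball (0 : E3) 1, ‖iteratedFDeriv ℝ j m v‖ = 0 := fun v hv => by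
      rw [norm_eq_zero]
      by_contra hne
      exact hv (hsupp (support_iteratedFDeriv_subset j hne))
    rw [← setIntegral_eq_integral_of_forall_compl_eq_zero hz]
    refine (setIntegral_mono_on (hint j).integrableOn
      (integrableOn_const measure_ball_lt_top.ne) measurableSet_ball
      (fun v _ => hM v j hj)).trans_eq ?_
    rw [setIntegral_const, smul_eq_mul, mul_comm]
  have h := Real.pow_mul_norm_iteratedFDeriv_fourier_le (K := 0) (N := (⊤ : ℕ∞)) (f := m) hm
    (fun k j hk _ => by
      obtain rfl : k = 0 := by simpa using hk
      simpa using hint j) (k := 0) (n := n) (by simp) (by simp) w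
  refine (h.trans' (by simp)).trans ?_
  simp only [pow_zero, one_mul, Nat.cast_zero, mul_zero, zero_add, Finset.range_one,
    Finset.sum_product, Finset.sum_singleton]
  gcongr
  refine (Finset.sum_le_card_nsmul _ _ _ fun j hj =>
    hbound j (by simpa [Nat.lt_succ_iff] using hj)).trans_eq ?_
  simp

lemma exists_norm_fourierInv_le :
    ∃ C : ℝ, 0 < C ∧ ∀ (M : ℝ) (m : E3 → ℂ), ContDiff ℝ (⊤ : ℕ∞) m → tsupport m ⊆ ball 0 1 →
      (∀ ξ, ∀ j ≤ 4, ‖iteratedFDeriv ℝ j m ξ‖ ≤ M) →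
      ∀ x, ‖𝓕⁻ m x‖ ≤ C * M * (1 + ‖x‖) ^ (-(4 : ℝ)) := by
  have hV : 0 < volume.real (ball (0 : E3) 1) :=
    ENNReal.toReal_pos (measure_ball_pos _ _ one_pos).ne' measure_ball_lt_top.ne
  refine ⟨8 * (1 + 2 ^ 4 * 5) * volume.real (ball (0 : E3) 1), by positivity,
    fun M m hm hsupp hM x => ?_⟩
  have h0 := pow_mul_norm_fourier_le hm hsupp 0 (fun ξ j hj => hM ξ j (by omega)) (-x)
  have h4 := pow_mul_norm_fourier_le hm hsupp 4 hM (-x)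
  rw [norm_neg] at h0 h4
  rw [Real.fourierInv_eq_fourier_neg, Real.rpow_neg (by positivity), ← div_eq_mul_inv,
    le_div_iff₀ (by positivity)]
  have hx := norm_nonneg x
  have hc : (1 + ‖x‖) ^ (4 : ℝ) ≤ 8 * (1 + ‖x‖ ^ 4) := by
    norm_cast
    nlinarith [sq_nonneg (‖x‖ - 1), sq_nonneg (‖x‖ ^ 2 - 1), sq_nonneg (‖x‖ ^ 2 - ‖x‖)]
  calc ‖𝓕 m (-x)‖ * (1 + ‖x‖) ^ (4 : ℝ) ≤ ‖𝓕 m (-x)‖ * (8 * (1 + ‖x‖ ^ 4)) := by gcongr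
    _ ≤ _ := by norm_num at h0 h4 ⊢; linarith

/-- A Fourier multiplier acts by convolution with the inverse transform of its symbol. -/
lemma fourierInv_mul_fourier {m u : E3 → ℂ} (hm : Integrable m) (hu : Integrable u) (x : E3) :
    (𝓕⁻ fun ξ => m ξ * 𝓕 u ξ) x = ∫ y, 𝓕⁻ m (x - y) * u y := by
  have hg : Integrable fun ξ => Real.fourierChar (inner ℝ ξ x) • m ξ := by
    have := (Real.fourierIntegral_convergent_iff (f := m) (-x)).2 hm
    simpa using this
  have h := VectorFourier.integral_fourierIntegral_smul_eq_flip (L := innerₗ E3) (μ := volume)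
    (ν := volume) Real.continuous_fourierChar continuous_inner hu hg
  rw [Real.fourierInv_eq]
  calc _ = _ := integral_congr_ae (Eventually.of_forall fun ξ => ?_)
    _ = _ := h
    _ = _ := integral_congr_ae (Eventually.of_forall fun y => ?_)
  · simp only [Circle.smul_def, smul_eq_mul, Real.fourier_eq, VectorFourier.fourierIntegral,
      innerₗ_apply_apply]
    ring_nf
  · simp only [smul_eq_mul, Real.fourierInv_eq, VectorFourier.fourierIntegral,
      LinearMap.flip_apply, innerₗ_apply_apply]
    rw [mul_comm]
    congr 1
    refine integral_congr_ae (Eventually.of_forall fun ξ => ?_)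
    simp only [smul_smul, ← AddChar.map_add_eq_mul, inner_sub_right, real_inner_comm y ξ]
    ring_nf

lemma fourierInv_comp_smul (m : E3 → ℂ) {N : ℝ} (hN : 0 < N) (x : E3) :
    𝓕⁻ m x = (N ^ 3 : ℝ) • 𝓕⁻ (fun ξ => m (N • ξ)) (N • x) := by
  rw [Real.fourierInv_eq, Real.fourierInv_eq]
  have h := Measure.integral_comp_smul (μ := (volume : Measure E3))
    (fun ξ => Real.fourierChar (inner ℝ ξ x) • m ξ) N
  have hi : ∀ ξ : E3, inner ℝ ξ (N • x) = inner ℝ (N • ξ) x := fun ξ => by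
    rw [real_inner_smul_left, real_inner_smul_right]
  simp only [hi]
  rw [h, smul_smul, finrank_euclideanSpace, Fintype.card_fin, abs_of_pos (by positivity),
    mul_inv_cancel₀ (by positivity), one_smul]

/-- Kernel bound for a symbol adapted to the ball of radius `N`. -/
lemma exists_enorm_fourierInv_le :
    ∃ C : ℝ, 0 < C ∧ ∀ (M N : ℝ), 0 < M → 0 < N → ∀ m : E3 → ℂ, ContDiff ℝ (⊤ : ℕ∞) m →
      tsupport m ⊆ ball 0 N →
      (∀ ξ : E3, ∀ j : ℕ, j ≤ 4 → ‖iteratedFDeriv ℝ j m ξ‖ ≤ M * N ^ (-(j : ℝ))) →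
      ∀ x, ‖𝓕⁻ m x‖ₑ ≤ ENNReal.ofReal (C * M * N ^ 3) * decayKernel (N • x) := by
  obtain ⟨C, hC, h⟩ := exists_norm_fourierInv_le
  refine ⟨C, hC, fun M N hM hN m hm hsupp hder x => ?_⟩
  have hb := h M (fun ξ => m (N • ξ)) (hm.comp (contDiff_const_smul N)) (fun ξ hξ => ?_)
    (fun ξ j hj => ?_) (N • x)
  · rw [fourierInv_comp_smul m hN, decayKernel, ← ENNReal.ofReal_mul (by positivity),
      ← ofReal_norm, norm_smul, Real.norm_of_nonneg (by positivity)]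
    refine ENNReal.ofReal_le_ofReal ?_
    calc N ^ 3 * ‖𝓕⁻ (fun ξ => m (N • ξ)) (N • x)‖
        ≤ N ^ 3 * (C * M * (1 + ‖N • x‖) ^ (-(4 : ℝ))) := by gcongr
      _ = _ := by ring
  · have h1 : N • ξ ∈ ball (0 : E3) N :=
      hsupp (tsupport_comp_subset_preimage m (continuous_const_smul N) hξ)
    rw [mem_ball_zero_iff, norm_smul, Real.norm_of_nonneg hN.le] at h1
    rw [mem_ball_zero_iff]
    exact (mul_lt_iff_lt_one_right hN).1 h1
  · rw [iteratedFDeriv_comp_const_smul N (hm.of_le (by exact_mod_cast le_top)), norm_smul,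
      norm_pow, Real.norm_of_nonneg hN.le]
    calc N ^ j * ‖iteratedFDeriv ℝ j m (N • ξ)‖ ≤ N ^ j * (M * N ^ (-(j : ℝ))) := by
          gcongr; exact hder _ j hj
      _ = M := by
          rw [Real.rpow_neg hN.le, Real.rpow_natCast]; field_simp

lemma map_smul_volume {N : ℝ} (hN : 0 < N) :
    Measure.map (fun x : E3 => N • x) volume = ENNReal.ofReal (N ^ (-(3 : ℝ))) • volume := by
  rw [Measure.map_addHaar_smul _ hN.ne', finrank_euclideanSpace, Fintype.card_fin,
    abs_of_pos (by positivity), Real.rpow_neg hN.le]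
  norm_cast

lemma lintegral_comp_smul {N : ℝ} (hN : 0 < N) {f : E3 → ℝ≥0∞} (hf : Measurable f) :
    ∫⁻ x, f (N • x) = ENNReal.ofReal (N ^ (-(3 : ℝ))) * ∫⁻ x, f x := by
  rw [← lintegral_map hf (measurable_const_smul N), map_smul_volume hN, lintegral_smul_measure,
    smul_eq_mul]

lemma eLpNorm_comp_smul {N : ℝ} (hN : 0 < N) (p : ℝ≥0∞) {f : E3 → ℝ≥0∞}
    (hf : Measurable f) :
    eLpNorm (fun x => f (N • x)) p volume =
      ENNReal.ofReal (N ^ (-3 / p.toReal)) * eLpNorm f p volume := by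
  have h := eLpNorm_map_measure (μ := volume) (p := p) (g := f) (f := fun x : E3 => N • x)
    hf.aestronglyMeasurable (measurable_const_smul N).aemeasurable
  rw [map_smul_volume hN, eLpNorm_smul_measure_of_ne_zero (by simp; positivity), smul_eq_mul,
    ENNReal.ofReal_rpow_of_nonneg (by positivity) ENNReal.toReal_nonneg,
    ← Real.rpow_mul hN.le] at h
  change _ = eLpNorm (f ∘ fun x : E3 => N • x) p volume at h
  rw [Function.comp_def] at h
  rw [← h, one_div, ENNReal.toReal_inv, div_eq_mul_inv]

lemma wnorm'_comp_smul_le {F : Type*} [NormedAddCommGroup F] {N : ℝ} (hN : 0 < N) {q : ℝ}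
    (hq : 0 < q) (u : E3 → F) :
    wnorm' (fun x => u (N⁻¹ • x)) q ≤ ENNReal.ofReal (N ^ (3 / q)) * wnorm' u q := by
  refine iSup₂_le fun l hl => ?_
  have hset : {x : E3 | l ≤ ‖u (N⁻¹ • x)‖} = (fun x : E3 => N⁻¹ • x) ⁻¹' {x | l ≤ ‖u x‖} := rfl
  rw [hset, Measure.addHaar_preimage_smul _ (inv_ne_zero hN.ne'), finrank_euclideanSpace,
    Fintype.card_fin, ENNReal.mul_rpow_of_nonneg _ _ (by positivity),
    ENNReal.ofReal_rpow_of_nonneg (by positivity) (by positivity)]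
  have hc : |((N⁻¹ ^ 3)⁻¹ : ℝ)| ^ (1 / q) = N ^ (3 / q) := by
    rw [inv_pow, inv_inv, abs_of_pos (by positivity), ← Real.rpow_natCast, ← Real.rpow_mul hN.le]
    norm_num [div_eq_mul_inv]
  rw [hc, mul_left_comm]
  gcongr
  exact le_iSup₂ (f := fun (l : ℝ) (_ : 0 < l) =>
    ENNReal.ofReal l * volume {x : E3 | l ≤ ‖u x‖} ^ (1 / q)) l hl

lemma rr_smul {N : ℝ} (hN : 0 ≤ N) (x : E3) : rr (N • x) = N * rr x := by
  unfold rr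
  simp only [PiLp.smul_apply, smul_eq_mul]
  rw [show (N * x 0) ^ 2 + (N * x 1) ^ 2 = N ^ 2 * (x 0 ^ 2 + x 1 ^ 2) by ring,
    Real.sqrt_mul (by positivity), Real.sqrt_sq hN]

lemma rotZ_smul (θ c : ℝ) (x : E3) : rotZ θ (c • x) = c • rotZ θ x :=
  (rotZIsometry θ).map_smul c x

lemma enorm_fourierInv_mul_fourier_le {m : E3 → ℂ} (hm : Integrable m) {u : E3 → ℂ}
    (hu : Integrable u) (hu' : Measurable u) {A N : ℝ} (hA : 0 ≤ A) (hN : 0 < N)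
    (h : ∀ x, ‖𝓕⁻ m x‖ₑ ≤ ENNReal.ofReal (A * N ^ 3) * decayKernel (N • x)) (x : E3) :
    ‖(𝓕⁻ fun ξ => m ξ * 𝓕 u ξ) x‖ₑ ≤
      ENNReal.ofReal A * ∫⁻ y, decayKernel (N • x - y) * ‖u (N⁻¹ • y)‖ₑ := by
  have hk := measurable_decayKernel
  have hmeas : Measurable fun y => decayKernel (N • x - y) * ‖u (N⁻¹ • y)‖ₑ := by fun_prop
  rw [fourierInv_mul_fourier hm hu]
  calc ‖∫ y, 𝓕⁻ m (x - y) * u y‖ₑ ≤ ∫⁻ y, ‖𝓕⁻ m (x - y) * u y‖ₑ :=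
        enorm_integral_le_lintegral_enorm _
    _ ≤ ∫⁻ y, ENNReal.ofReal (A * N ^ 3) *
          (decayKernel (N • x - N • y) * ‖u (N⁻¹ • N • y)‖ₑ) := by
        refine lintegral_mono fun y => ?_
        rw [enorm_mul, inv_smul_smul₀ hN.ne', ← mul_assoc, ← smul_sub]
        gcongr
        exact h _
    _ = ENNReal.ofReal (A * N ^ 3) * (ENNReal.ofReal (N ^ (-(3 : ℝ))) *
          ∫⁻ y, decayKernel (N • x - y) * ‖u (N⁻¹ • y)‖ₑ) := by
        rw [lintegral_const_mul' _ _ ENNReal.ofReal_ne_top, ← lintegral_comp_smul hN hmeas]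
    _ = _ := by
        rw [← mul_assoc, ← ENNReal.ofReal_mul (by positivity), Real.rpow_neg hN.le, mul_assoc]
        norm_cast
        rw [mul_inv_cancel₀ (by positivity), mul_one]

/-- Rescaling a weighted estimate for the model kernel to frequency `N`. -/
lemma eLpNorm_weight_le_of_enorm_le {q : ℝ} {p : ℝ≥0∞} {α : ℝ} (hq : 0 < q) {C : ℝ≥0∞}
    (hC : C ≠ ∞) (hW : ∀ v : E3 → ℂ, Measurable v → (∀ θ x, v (rotZ θ x) = v x) →
      eLpNorm (fun x => ENNReal.ofReal (rr x ^ α) * ∫⁻ y, decayKernel (x - y) * ‖v y‖ₑ) p volume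
        ≤ C * wnorm' v q)
    {u : E3 → ℂ} (hum : Measurable u) (hu : ∀ θ x, u (rotZ θ x) = u x) {A N : ℝ} (hA : 0 ≤ A)
    (hN : 0 < N) {T : E3 → ℂ} (hT : ∀ x, ‖T x‖ₑ ≤
      ENNReal.ofReal A * ∫⁻ y, decayKernel (N • x - y) * ‖u (N⁻¹ • y)‖ₑ) :
    eLpNorm (fun x => rr x ^ α • T x) p volume ≤
      ENNReal.ofReal (A * C.toReal * N ^ (3 / q - 3 / p.toReal - α)) * wnorm' u q := by
  set v : E3 → ℂ := fun x => u (N⁻¹ • x) with hv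
  have hvm : Measurable v := hum.comp (measurable_const_smul _)
  set G : E3 → ℝ≥0∞ := fun x =>
    ENNReal.ofReal (rr x ^ α) * ∫⁻ y, decayKernel (x - y) * ‖v y‖ₑ with hG
  have hGm : Measurable G := by
    have := measurable_lintegral_decayKernel_mul hvm.enorm
    have := measurable_rr
    fun_prop
  have hpt : ∀ x, ‖rr x ^ α • T x‖ₑ ≤
      (A * N ^ (-α)).toNNReal * ‖G (N • x)‖ₑ := fun x => by
    have hr := rr_nonneg x
    rw [enorm_eq_self, enorm_smul, Real.enorm_of_nonneg (by positivity), hG]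
    refine (mul_le_mul' le_rfl (hT x)).trans_eq ?_
    simp only
    rw [← mul_assoc, ← mul_assoc, rr_smul hN.le, Real.mul_rpow hN.le hr]
    congr 1
    change _ = ENNReal.ofReal _ * _
    rw [← ENNReal.ofReal_mul (by positivity), ← ENNReal.ofReal_mul (by positivity),
      Real.rpow_neg hN.le]
    congr 1
    field_simp
  calc eLpNorm (fun x => rr x ^ α • T x) p volume
      ≤ (A * N ^ (-α)).toNNReal • eLpNorm (fun x => G (N • x)) p volume :=
        eLpNorm_le_nnreal_smul_eLpNorm_of_ae_le_mul' (Eventually.of_forall hpt) p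
    _ = ENNReal.ofReal (A * N ^ (-α)) *
          (ENNReal.ofReal (N ^ (-3 / p.toReal)) * eLpNorm G p volume) := by
        rw [eLpNorm_comp_smul hN p hGm]; rfl
    _ ≤ ENNReal.ofReal (A * N ^ (-α)) * (ENNReal.ofReal (N ^ (-3 / p.toReal)) *
          (ENNReal.ofReal C.toReal * (ENNReal.ofReal (N ^ (3 / q)) * wnorm' u q))) := by
        gcongr
        rw [ENNReal.ofReal_toReal hC]
        refine (hW v hvm fun θ x => ?_).trans (by gcongr; exact wnorm'_comp_smul_le hN hq _)
        simp only [hv, ← rotZ_smul, hu]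
    _ = _ := by
        simp only [← mul_assoc]
        rw [← ENNReal.ofReal_mul (by positivity), ← ENNReal.ofReal_mul (by positivity),
          ← ENNReal.ofReal_mul (by positivity)]
        congr 2
        rw [show 3 / q - 3 / p.toReal - α = -α + -3 / p.toReal + 3 / q by ring,
          Real.rpow_add hN, Real.rpow_add hN]
        ring

/-- Axisymmetric Bernstein inequality in weak Lebesgue spaces. -/
theorem stmt5 (q : ℝ) (p : ℝ≥0∞) (α : ℝ) (hq : 1 < q) (hqp : ENNReal.ofReal q < p)
    (hα : (-2 / p.toReal < α ∧ α < 1 / q - 1 / p.toReal) ∨ (p = ⊤ ∧ α = 0)) :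
    ∃ C : ℝ, 0 < C ∧
      ∀ (M N : ℝ), 0 < M → 0 < N →
        ∀ m : E3 → ℂ, ContDiff ℝ (⊤:ℕ∞) m → tsupport m ⊆ Metric.ball 0 N →
          (∀ ξ : E3, ∀ j : ℕ, j ≤ 100 → ‖iteratedFDeriv ℝ j m ξ‖ ≤ M * N ^ (-(j:ℝ))) →
          ∀ u : SchwartzMap E3 ℂ, (∀ θ x, u (rotZ θ x) = u x) →
            eLpNorm (fun x => rr x ^ α • (𝓕⁻ fun ξ => m ξ * 𝓕 (⇑u) ξ) x) p volume ≤
              ENNReal.ofReal (C * M * N ^ (3 / q - 3 / p.toReal - α)) * wnorm' (⇑u) q := by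
  have hα1 : α < 1 / q - 1 / p.toReal := by
    rcases hα with h | ⟨rfl, rfl⟩
    · exact h.2
    · simp; linarith
  have hα2 : p ≠ ∞ → -2 / p.toReal < α := fun hp => hα.elim And.left fun h => absurd h.1 hp
  have hα3 : p = ∞ → 0 ≤ α := by
    rintro rfl
    rcases hα with h | h
    · simpa using h.1.le
    · exact h.2.ge
  obtain ⟨C₁, hC₁, hK⟩ := exists_enorm_fourierInv_le
  obtain ⟨C₂, hC₂, hC₂0, hW⟩ := exists_eLpNorm_weight_le_wnorm' hq hqp hα1 hα2 hα3
  refine ⟨C₁ * C₂.toReal, mul_pos hC₁ (ENNReal.toReal_pos hC₂0 hC₂), ?_⟩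
  intro M N hM hN m hm hsupp hder u hu
  have hcs : HasCompactSupport m :=
    HasCompactSupport.of_support_subset_isCompact (isCompact_closedBall (0 : E3) N)
      ((subset_tsupport m).trans (hsupp.trans ball_subset_closedBall))
  have hmi : Integrable m := hm.continuous.integrable_of_hasCompactSupport hcs
  have hum : Measurable u := u.continuous.measurable
  have hT := enorm_fourierInv_mul_fourier_le (A := C₁ * M) hmi u.integrable hum (by positivity) hN
    (hK M N hM hN m hm hsupp fun ξ j hj => hder ξ j (by omega))
  have h := eLpNorm_weight_le_of_enorm_le (by linarith) hC₂ hW hum hu (by positivity) hN hT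
  rwa [mul_right_comm C₁ M] at h
end
end
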